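/- arXiv:2011.02700 — 2 statements merged into one kernel-verified Lean document; each statement's English description precedes it below -/
import Mathlib

section
/- Suppose (2k−1)·α > 1, k ≥ τ·ln τ/(τ−1), and 0 < r < 1/ln τ. Then lim sup_{n→∞} E2(n)/E1(n)² ≤ 1. -/
open Filter Finset

/-- Domain size `d = n^α` of Model RB. -/
noncomputable def dRB (α : ℝ) (n : ℕ) : ℝ := (n : ℝ) ^ α

/-- `m = n · ln d`. -/
noncomputable def mRB (α : ℝ) (n : ℕ) : ℝ := (n : ℝ) * Real.log (dRB α n)

/-- `f_n(s) = 1 + (p/(1-p)) (s^k - d^{-k})/(1 - d^{-k})`. -/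
noncomputable def fRB (α p : ℝ) (k n : ℕ) (s : ℝ) : ℝ :=
  1 + (p / (1 - p)) * (s ^ k - dRB α n ^ (-(k : ℝ))) / (1 - dRB α n ^ (-(k : ℝ)))

/-- `B_n(S) = C(n,S) (1/d)^S (1-1/d)^{n-S}`. -/
noncomputable def BRB (α : ℝ) (n S : ℕ) : ℝ :=
  (n.choose S : ℝ) * (1 / dRB α n) ^ S * (1 - 1 / dRB α n) ^ (n - S)

/-- `W_n(S) = f_n(S/n)^{r m}`. -/
noncomputable def WRB (α p r : ℝ) (k n S : ℕ) : ℝ :=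
  fRB α p k n ((S : ℝ) / (n : ℝ)) ^ (r * mRB α n)

/-- `Φ_n(S) = B_n(S) W_n(S)`. -/
noncomputable def PhiRB (α p r : ℝ) (k n S : ℕ) : ℝ := BRB α n S * WRB α p r k n S

/-- `g(s) = -k(k-1)(1-s)s^{k-1}/2`. -/
noncomputable def gRB (k : ℕ) (s : ℝ) : ℝ :=
  -((k : ℝ) * ((k : ℝ) - 1)) * (1 - s) * s ^ (k - 1) / 2

/-- `η₁(n) = 1/d + λ/(n^{1-(k-1)α} ln d)`. -/
noncomputable def eta1 (α lam : ℝ) (k n : ℕ) : ℝ :=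
  1 / dRB α n + lam / ((n : ℝ) ^ (1 - ((k : ℝ) - 1) * α) * Real.log (dRB α n))

/-- First moment `E[X] = d^n (1-p)^{r m}`. -/
noncomputable def E1RB (α p r : ℝ) (n : ℕ) : ℝ := dRB α n ^ n * (1 - p) ^ (r * mRB α n)

/-- Second moment `E[X²]`. -/
noncomputable def E2RB (α p r : ℝ) (k n : ℕ) : ℝ :=
  ∑ S ∈ Finset.range (n + 1),
    dRB α n ^ n * (n.choose S : ℝ) * (dRB α n - 1) ^ (n - S) *
      ((1 - p) * ((S.choose k : ℝ) / (n.choose k : ℝ)) +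
        ((1 - p) ^ 2 - p * (1 - p) * dRB α n ^ (-(k : ℝ)) / (1 - dRB α n ^ (-(k : ℝ)))) *
          (1 - (S.choose k : ℝ) / (n.choose k : ℝ))) ^ (r * mRB α n)


lemma log_bound (c : ℝ) (hc : 0 < c) (k : ℕ) (hk2 : 2 ≤ k)
    (hk : (1 + c) * Real.log (1 + c) ≤ k * c) (s : ℝ) (hs0 : 0 ≤ s) (hs1 : s ≤ 1) :
    Real.log (1 + c * s ^ k) ≤ s * Real.log (1 + c) := by
  rcases hs0.eq_or_lt with h | hs
  · subst h
    simp [show k ≠ 0 by omega]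
  have key : ∀ z, 0 ≤ z → z ≤ c → (1 + z) * Real.log (1 + z) ≤ k * z := by
    intro z hz hzc
    have hm : (1 + c : ℝ) ∈ Set.Ici (0:ℝ) := by simp only [Set.mem_Ici]; linarith
    have hm1 : (1 : ℝ) ∈ Set.Ici (0:ℝ) := by simp
    have ha : (0:ℝ) ≤ 1 - z / c := by rw [sub_nonneg, div_le_one hc]; exact hzc
    have hb : (0:ℝ) ≤ z / c := by positivity
    have h1 := Real.convexOn_mul_log.2 hm1 hm ha hb (by ring)
    have h2 : (1 - z / c) * 1 + (z / c) * (1 + c) = 1 + z := by field_simp; ring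
    simp only [smul_eq_mul] at h1
    rw [h2] at h1
    have h3 : z / c * ((1 + c) * Real.log (1 + c)) ≤ z / c * (k * c) := by gcongr
    have h4 : z / c * (k * c) = k * z := by field_simp
    simp at h1
    linarith
  have hmono : MonotoneOn (fun x : ℝ => Real.log (1 + c * x ^ k) / x) (Set.Icc s 1) := by
    have hd : ∀ x ∈ Set.Icc s 1, HasDerivAt (fun x : ℝ => Real.log (1 + c * x ^ k) / x)
        (((c * (k * x ^ (k - 1))) / (1 + c * x ^ k) * x - Real.log (1 + c * x ^ k) * 1) / x ^ 2) x := by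
      intro x hx
      have hx0 : 0 < x := lt_of_lt_of_le hs hx.1
      have h1 : HasDerivAt (fun x : ℝ => 1 + c * x ^ k) (c * (k * x ^ (k - 1))) x :=
        ((hasDerivAt_pow k x).const_mul c).const_add 1
      exact (h1.log (by positivity)).div (hasDerivAt_id x) hx0.ne'
    apply monotoneOn_of_deriv_nonneg (convex_Icc s 1)
    · exact fun x hx => (hd x hx).continuousAt.continuousWithinAt
    · exact fun x hx => (hd x (interior_subset hx)).differentiableAt.differentiableWithinAt
    · intro x hx
      have hx' := interior_subset hx
      rw [(hd x hx').deriv]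
      have hx0 : 0 < x := lt_of_lt_of_le hs hx'.1
      apply div_nonneg _ (by positivity)
      have hz := key (c * x ^ k) (by positivity) (by
        have : x ^ k ≤ 1 := pow_le_one₀ hx0.le hx'.2
        nlinarith)
      have h5 : (c * (k * x ^ (k - 1))) / (1 + c * x ^ k) * x = k * (c * x ^ k) / (1 + c * x ^ k) := by
        obtain ⟨j, rfl⟩ : ∃ j, k = j + 1 := ⟨k - 1, by omega⟩
        simp only [Nat.add_sub_cancel]
        rw [pow_succ]; ring
      rw [h5, mul_one, sub_nonneg, le_div_iff₀ (by positivity)]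
      linarith
  have := hmono (Set.left_mem_Icc.2 hs1) (Set.right_mem_Icc.2 hs1) hs1
  simp only [one_pow, mul_one, div_one] at this
  rw [div_le_iff₀ hs] at this
  linarith

lemma choose_bound (n S : ℕ) (hS : 1 ≤ S) (hn : S ≤ n) :
    (n.choose S : ℝ) ≤ Real.exp (S * (1 + Real.log (n / S))) := by
  have hS0 : (0:ℝ) < S := by exact_mod_cast hS
  have hn0 : (0:ℝ) < n := by exact_mod_cast (lt_of_lt_of_le hS hn)
  have h1 : (n.choose S : ℝ) ≤ (n:ℝ) ^ S / (S.factorial : ℝ) := Nat.choose_le_pow_div S n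
  have h2 := Real.pow_div_factorial_le_exp (S:ℝ) hS0.le S
  have h3 : Real.exp (S * (1 + Real.log (n / S))) = Real.exp S * (n / S) ^ S := by
    rw [mul_add, mul_one, Real.exp_add, Real.exp_nat_mul, Real.exp_log (by positivity)]
    
  rw [h3]
  calc _ ≤ _ := h1
    _ = (S:ℝ)^S / S.factorial * (n / S : ℝ)^S := by rw [div_pow]; field_simp
    _ ≤ _ := by gcongr

lemma q_bound (n S k : ℕ) (hn : S ≤ n) (hn1 : 1 ≤ n) :
    (S.choose k : ℝ) / (n.choose k : ℝ) ≤ ((S:ℝ) / n) ^ k := by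
  have h : ∀ k, S.descFactorial k * n ^ k ≤ S ^ k * n.descFactorial k := by
    intro k
    induction k with
    | zero => simp
    | succ j ih =>
      rw [Nat.descFactorial_succ, Nat.descFactorial_succ, pow_succ, pow_succ]
      have h1 : (S - j) * n ≤ S * (n - j) := by
        rw [Nat.mul_sub, Nat.sub_mul]
        have : j * S ≤ j * n := Nat.mul_le_mul_left _ hn
        rw [Nat.mul_comm S j]
        omega
      calc _ = ((S - j) * n) * (S.descFactorial j * n ^ j) := by ring
        _ ≤ (S * (n - j)) * (S ^ j * n.descFactorial j) := Nat.mul_le_mul h1 ih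
        _ = _ := by ring
  have h2 := h k
  rw [Nat.descFactorial_eq_factorial_mul_choose, Nat.descFactorial_eq_factorial_mul_choose] at h2
  have h3 : S.choose k * n ^ k ≤ S ^ k * n.choose k := by
    have : k.factorial * (S.choose k * n ^ k) ≤ k.factorial * (S ^ k * n.choose k) := by
      calc _ = _ := by ring
        _ ≤ _ := h2
        _ = _ := by ring
    exact Nat.le_of_mul_le_mul_left this (Nat.factorial_pos k)
  rcases Nat.eq_zero_or_pos (n.choose k) with h0 | h0
  · rw [h0]; simp; positivity
  have hn0 : (0:ℝ) < n := by exact_mod_cast hn1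
  have h0' : (0:ℝ) < n.choose k := by exact_mod_cast h0
  rw [div_pow, div_le_div_iff₀ h0' (by positivity)]
  exact_mod_cast h3

lemma moment (n : ℕ) (μ a : ℝ) (hμ0 : 0 ≤ μ) (hμ1 : μ ≤ 1) (ha0 : 0 ≤ a) (ha1 : a ≤ 1) :
    ∑ S ∈ Finset.range (n + 1), (n.choose S : ℝ) * μ ^ S * (1 - μ) ^ (n - S) *
      Real.exp (a * max (S - n * μ) 0) ≤ Real.exp (a ^ 2 * (n * μ)) + 2 * √(a ^ 2 * (n * μ)) := by
  have hB0 : ∀ S, 0 ≤ (n.choose S : ℝ) * μ ^ S * (1 - μ) ^ (n - S) := fun S => by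
    have : 0 ≤ 1 - μ := by linarith
    positivity
  have hsum : ∑ S ∈ Finset.range (n + 1), (n.choose S : ℝ) * μ ^ S * (1 - μ) ^ (n - S) = 1 := by
    have := add_pow μ (1 - μ) n
    rw [show μ + (1 - μ) = 1 by ring, one_pow] at this
    refine Eq.trans ?_ this.symm
    exact Finset.sum_congr rfl fun i _ => by ring
  have hexp : ∑ S ∈ Finset.range (n + 1), (n.choose S : ℝ) * μ ^ S * (1 - μ) ^ (n - S) *
      Real.exp (a * (S - n * μ)) ≤ Real.exp (a ^ 2 * (n * μ)) := by
    have h1 := add_pow (μ * Real.exp a) (1 - μ) n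
    have h2 : ∑ S ∈ Finset.range (n + 1), (n.choose S : ℝ) * μ ^ S * (1 - μ) ^ (n - S) *
      Real.exp (a * (S - n * μ)) = (μ * Real.exp a + (1 - μ)) ^ n * Real.exp (-(a * n * μ)) := by
      rw [h1, Finset.sum_mul]
      refine Finset.sum_congr rfl fun S _ => ?_
      rw [show a * (S - n * μ) = S * a + (-(a * n * μ)) by ring, Real.exp_add, Real.exp_nat_mul, mul_pow]
      ring
    rw [h2]
    have h3 : Real.exp a ≤ 1 + a + a ^ 2 := by
      have := Real.abs_exp_sub_one_sub_id_le (x := a) (by rw [abs_of_nonneg ha0]; exact ha1)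
      have := (abs_le.1 this).2
      linarith
    have h4 : μ * Real.exp a + (1 - μ) ≤ Real.exp (μ * (a + a ^ 2)) := by
      have := Real.add_one_le_exp (μ * (a + a ^ 2))
      nlinarith
    have h5 : 0 ≤ μ * Real.exp a + (1 - μ) := by
      have := Real.exp_pos a
      have : 0 ≤ 1 - μ := by linarith
      positivity
    calc _ ≤ (Real.exp (μ * (a + a ^ 2))) ^ n * Real.exp (-(a * n * μ)) := by gcongr
      _ = _ := by rw [← Real.exp_nat_mul, ← Real.exp_add]; congr 1; ring
  have hvar : ∑ S ∈ Finset.range (n + 1), (n.choose S : ℝ) * μ ^ S * (1 - μ) ^ (n - S) *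
      (S - n * μ) ^ 2 ≤ n * μ := by
    have h := congrArg (Polynomial.eval μ) (bernsteinPolynomial.variance ℝ n)
    simp [Polynomial.eval_finsetSum, bernsteinPolynomial] at h
    calc _ = n * μ * (1 - μ) := by
            rw [← h]; exact Finset.sum_congr rfl fun i _ => by ring
      _ ≤ n * μ := by
        have : 0 ≤ n * μ := by positivity
        nlinarith
  set v := a ^ 2 * (n * μ) with hv
  have hv0 : 0 ≤ v := by positivity
  rcases hv0.eq_or_lt with h0 | hvpos
  · -- v = 0
    have hz : a = 0 ∨ (n:ℝ) * μ = 0 := by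
      rw [hv] at h0
      rcases mul_eq_zero.1 h0.symm with h | h
      · left; exact pow_eq_zero_iff (two_ne_zero) |>.1 h
      · right; exact h
    rw [← h0]
    simp only [Real.exp_zero, Real.sqrt_zero, mul_zero, add_zero]
    rcases hz with h | h
    · subst h; simpa using hsum.le
    · rw [← h0, Real.exp_zero] at hexp
      simp only [h, sub_zero] at hexp ⊢
      refine le_trans (Finset.sum_le_sum fun S _ => ?_) hexp
      rw [max_eq_left (by positivity)]
  set t := √v with ht
  have htp : 0 < t := Real.sqrt_pos.2 hvpos
  have htt : t * t = v := Real.mul_self_sqrt hv0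
  have hpt : ∀ y : ℝ, Real.exp (a * max y 0) ≤ Real.exp (a * y) + t + a ^ 2 / t * y ^ 2 := by
    intro y
    have hp : 0 ≤ a ^ 2 / t * y ^ 2 := by positivity
    rcases le_total 0 y with h | h
    · rw [max_eq_left h]; linarith
    · rw [max_eq_right h, mul_zero, Real.exp_zero]
      have h1 := Real.add_one_le_exp (a * y)
      have h2 : -(a * y) ≤ t + a ^ 2 / t * y ^ 2 := by
        have : a ^ 2 / t * y ^ 2 = (a * y) ^ 2 / t := by ring
        rw [this, ← sub_le_iff_le_add', le_div_iff₀ htp]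
        nlinarith [sq_nonneg (a * y + t), sq_nonneg (a * y), sq_nonneg t]
      linarith
  calc _ ≤ ∑ S ∈ Finset.range (n + 1), ((n.choose S : ℝ) * μ ^ S * (1 - μ) ^ (n - S) *
      Real.exp (a * (S - n * μ)) + t * ((n.choose S : ℝ) * μ ^ S * (1 - μ) ^ (n - S)) +
        a ^ 2 / t * ((n.choose S : ℝ) * μ ^ S * (1 - μ) ^ (n - S) * (S - n * μ) ^ 2)) := by
        refine Finset.sum_le_sum fun S _ => ?_
        have := mul_le_mul_of_nonneg_left (hpt (S - n * μ)) (hB0 S)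
        linarith
    _ ≤ Real.exp v + t * 1 + a ^ 2 / t * (n * μ) := by
        rw [Finset.sum_add_distrib, Finset.sum_add_distrib, ← Finset.mul_sum, ← Finset.mul_sum, hsum]
        gcongr
    _ = _ := by
        have : a ^ 2 / t * (n * μ) = t := by
          rw [div_mul_eq_mul_div, ← hv, ← htt]; field_simp
        rw [this]; ring

lemma pow_sub_bound (k : ℕ) (x y s : ℝ) (hy : 0 ≤ y) (hx : 0 ≤ x) (hxs : x ≤ s) :
    x ^ k - y ^ k ≤ k * s ^ (k - 1) * max (x - y) 0 := by
  have hs : 0 ≤ s := hx.trans hxs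
  rcases le_total x y with h | h
  · rw [max_eq_right (by linarith)]
    have : x ^ k ≤ y ^ k := by gcongr
    linarith
  · rw [max_eq_left (by linarith)]
    rw [← Commute.geom_sum₂_mul (Commute.all x y) k]
    refine mul_le_mul_of_nonneg_right ?_ (by linarith)
    calc _ ≤ ∑ i ∈ Finset.range k, s ^ (k - 1) := by
          refine Finset.sum_le_sum fun i hi => ?_
          have hi := Finset.mem_range.1 hi
          calc x ^ i * y ^ (k - 1 - i) ≤ s ^ i * s ^ (k - 1 - i) := by
                gcongr; linarith
            _ = s ^ (k - 1) := by rw [← pow_add]; congr 1; omega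
      _ = _ := by simp

set_option maxHeartbeats 2000000 in
lemma ratio_bound (α p r : ℝ) (k n : ℕ) (hα : 0 < α) (hk : 2 ≤ k) (c : ℝ)
    (hp1 : p < 1) (hc : c = p / (1 - p)) (hc0 : 0 < c)
    (hkc : (1 + c) * Real.log (1 + c) ≤ k * c) (hr0 : 0 < r)
    (ε e3 : ℝ) (he3 : r * Real.log (1 + c) = 1 - e3) (hn : 2 ≤ n)
    (hδ : dRB α n ^ (-(k : ℝ)) ≤ 1 / 2) (hδc : 2 * c * dRB α n ^ (-(k : ℝ)) ≤ 1)
    (a : ℝ) (ha : a = 2 * r * c * k * (α * Real.log n) * ((n:ℝ) ^ (ε - α)) ^ (k - 1)) (ha1 : a ≤ 1)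
    (hB2 : r * c * (α * Real.log n) * ((n:ℝ) ^ (-(α * e3 / 2))) ^ (k - 1) ≤ 1)
    (ρ : ℝ) (hρ1 : ρ < 1) (hρε : Real.exp (2 - ε * Real.log n) ≤ ρ)
    (hρ3 : Real.exp (2 - α * e3 / 2 * Real.log n) ≤ ρ) :
    0 ≤ E2RB α p r k n / E1RB α p r n ^ 2 ∧ 
    E2RB α p r k n / E1RB α p r n ^ 2 ≤
      Real.exp (a ^ 2 * (n * (1 / dRB α n))) + 2 * √(a ^ 2 * (n * (1 / dRB α n))) + ρ / (1 - ρ) := by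
  have hn0 : (0:ℝ) < n := by exact_mod_cast (by omega : 0 < n)
  have hn1 : (1:ℝ) < n := by exact_mod_cast (by omega : 1 < n)
  have hl : 0 < Real.log n := Real.log_pos hn1
  have hlogd : Real.log (dRB α n) = α * Real.log n := by unfold dRB; rw [Real.log_rpow hn0]
  have hd1 : 1 < dRB α n := Real.one_lt_rpow hn1 hα
  have hm : mRB α n = n * (α * Real.log n) := by unfold mRB; rw [hlogd]
  set d := dRB α n with hd
  have hd0 : 0 < d := by linarith
  set δ := d ^ (-(k : ℝ)) with hδd
  have hδ0 : 0 < δ := Real.rpow_pos_of_pos hd0 _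
  have hδμ : δ = (1 / d) ^ k := by
    rw [hδd, Real.rpow_neg hd0.le, Real.rpow_natCast, one_div, inv_pow]
  set M := r * mRB α n with hM
  have hM0 : 0 < M := by rw [hM, hm]; positivity
  have hρ0 : 0 < ρ := lt_of_lt_of_le (Real.exp_pos _) hρε
  have hp1' : 0 < 1 - p := by linarith
  have hdlt : 0 < 1 - δ := by linarith
  -- q and F
  set F : ℝ → ℝ := fun q => 1 + c * ((q - δ) / (1 - δ)) with hF
  have hF0 : ∀ q, 0 ≤ q → 0 ≤ F q := by
    intro q hq
    have h1 : -1 ≤ c * ((q - δ) / (1 - δ)) := by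
      rw [← mul_div_assoc, le_div_iff₀ hdlt]
      nlinarith [mul_nonneg hc0.le hq]
    simp only [hF]; linarith
  have hFm : ∀ q q', q ≤ q' → F q ≤ F q' := by
    intro q q' h
    simp only [hF]; gcongr
  have hq0 : ∀ S : ℕ, 0 ≤ (S.choose k : ℝ) / (n.choose k : ℝ) := fun S => by positivity
  have hbase : ∀ q, ((1 - p) * q + ((1 - p) ^ 2 - p * (1 - p) * δ / (1 - δ)) * (1 - q)) = (1 - p) ^ 2 * F q := by
    intro q
    simp only [hF, hc]
    field_simp
    ring
  have hratio : E2RB α p r k n / E1RB α p r n ^ 2 = ∑ S ∈ Finset.range (n + 1),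
      (n.choose S : ℝ) * (1 / d) ^ S * (1 - 1 / d) ^ (n - S) *
        F ((S.choose k : ℝ) / (n.choose k : ℝ)) ^ M := by
    unfold E2RB E1RB
    rw [Finset.sum_div]
    refine Finset.sum_congr rfl fun S hS => ?_
    have hSn : S ≤ n := by have := Finset.mem_range.1 hS; omega
    rw [← hd, ← hδd, ← hM, hbase, Real.mul_rpow (by positivity) (hF0 _ (hq0 S)), ← Real.rpow_natCast (1 - p) 2, ← Real.rpow_mul hp1'.le,
      mul_comm _ M, Real.rpow_mul hp1'.le, Real.rpow_natCast]
    have hX : 0 < (1 - p) ^ M := Real.rpow_pos_of_pos hp1' _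
    have e1 : (1 - 1 / d) ^ (n - S) = (d - 1) ^ (n - S) / d ^ (n - S) := by
      rw [← div_pow]; congr 1; field_simp
    have e2 : d ^ n = d ^ S * d ^ (n - S) := by rw [← pow_add]; congr 1; omega
    rw [e1, e2, one_div, inv_pow]
    field_simp
  have hμ0 : 0 ≤ 1 / d := by positivity
  have hμ1 : 1 / d ≤ 1 := by rw [div_le_one hd0]; linarith
  have hμ1' : 0 ≤ 1 - 1 / d := by linarith
  rw [hratio]
  refine ⟨Finset.sum_nonneg fun S _ => mul_nonneg (by positivity) (Real.rpow_nonneg (hF0 _ (hq0 S)) _), ?_⟩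
  have ha0 : 0 ≤ a := by rw [ha]; positivity
  have hexpM : ∀ x : ℝ, 0 < x → x ^ M = Real.exp (M * Real.log x) := fun x hx => by
    rw [Real.rpow_def_of_pos hx, mul_comm]
  have hterm : ∀ S ∈ Finset.range (n + 1), (n.choose S : ℝ) * (1 / d) ^ S * (1 - 1 / d) ^ (n - S) *
        F ((S.choose k : ℝ) / (n.choose k : ℝ)) ^ M ≤
      (n.choose S : ℝ) * (1 / d) ^ S * (1 - 1 / d) ^ (n - S) *
        Real.exp (a * max (S - n * (1 / d)) 0) + (if S = 0 then 0 else ρ ^ S) := by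
    intro S hS
    have hSn : S ≤ n := by have := Finset.mem_range.1 hS; omega
    have hSn' : (S:ℝ) ≤ n := by exact_mod_cast hSn
    set s := (S:ℝ) / n with hs
    have hs0 : 0 ≤ s := by positivity
    have hs1 : s ≤ 1 := by rw [hs, div_le_one hn0]; exact hSn'
    have hns : (S:ℝ) = n * s := by rw [hs]; field_simp
    have hFq : F ((S.choose k : ℝ) / (n.choose k : ℝ)) ^ M ≤ F (s ^ k) ^ M :=
      Real.rpow_le_rpow (hF0 _ (hq0 S)) (hFm _ _ (q_bound n S k hSn (by omega))) hM0.le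
    have hBn : 0 ≤ (n.choose S : ℝ) * (1 / d) ^ S * (1 - 1 / d) ^ (n - S) := by positivity
    have hρS : 0 ≤ (if S = 0 then 0 else ρ ^ S) := by split_ifs <;> positivity
    by_cases hcase : s ≤ (n:ℝ) ^ (ε - α)
    · -- typical region
      refine le_trans (mul_le_mul_of_nonneg_left ?_ hBn) (le_add_of_nonneg_right hρS)
      refine hFq.trans ?_
      have h1 : F (s ^ k) ≤ Real.exp (c * ((s ^ k - δ) / (1 - δ))) := by
        have := Real.add_one_le_exp (c * ((s ^ k - δ) / (1 - δ)))
        simp only [hF]; linarith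
      refine (Real.rpow_le_rpow (hF0 _ (by positivity)) h1 hM0.le).trans ?_
      rw [← Real.exp_mul]
      apply Real.exp_le_exp.2
      have h2 := pow_sub_bound k s (1 / d) _ hμ0 hs0 hcase
      rw [← hδμ] at h2
      set Y := (k:ℝ) * ((n:ℝ) ^ (ε - α)) ^ (k - 1) * max (s - 1 / d) 0 with hY
      have hY0 : 0 ≤ Y := by positivity
      have h3 : (s ^ k - δ) / (1 - δ) ≤ 2 * Y := by
        rw [div_le_iff₀ hdlt]
        have h5 := mul_nonneg hY0 (sub_nonneg.2 hδ)
        linarith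
      have h4 : max ((S:ℝ) - n * (1 / d)) 0 = n * max (s - 1 / d) 0 := by
        rw [mul_max_of_nonneg _ _ hn0.le, mul_zero, hns]; congr 1; ring
      calc c * ((s ^ k - δ) / (1 - δ)) * M ≤ c * (2 * Y) * M := by gcongr
        _ = _ := by rw [h4, ha, hM, hm, hY]; ring
    · -- tail region
      push Not at hcase
      have hspos : 0 < s := lt_of_le_of_lt (by positivity) hcase
      have hS1 : 1 ≤ S := by
        rcases Nat.eq_zero_or_pos S with h | h
        · rw [h] at hs; simp at hs; linarith
        · exact h
      have hS0 : (0:ℝ) < S := by exact_mod_cast hS1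
      rw [if_neg (by omega)]
      refine le_trans ?_ (le_add_of_nonneg_left (by positivity))
      have hF1 : F (s ^ k) ≤ 1 + c * s ^ k := by
        have hsk : s ^ k ≤ 1 := pow_le_one₀ hs0 hs1
        have : (s ^ k - δ) / (1 - δ) ≤ s ^ k := by
          rw [div_le_iff₀ hdlt]
          have h5 := mul_nonneg hδ0.le (sub_nonneg.2 hsk)
          linarith
        simp only [hF]; gcongr
      have hW : F ((S.choose k : ℝ) / (n.choose k : ℝ)) ^ M ≤ Real.exp (M * Real.log (1 + c * s ^ k)) := by
        rw [← hexpM _ (by positivity)]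
        exact hFq.trans (Real.rpow_le_rpow (hF0 _ (by positivity)) hF1 hM0.le)
      have hC := choose_bound n S hS1 hSn
      have hlogs : Real.log ((n:ℝ) / S) = - Real.log s := by
        rw [← Real.log_inv, hs, inv_div]
      have hdS : (1 / d) ^ S = Real.exp (S * (-(α * Real.log n))) := by
        rw [Real.exp_nat_mul, Real.exp_neg, ← hlogd, Real.exp_log hd0, one_div]
      have hX : (1 - 1 / d) ^ (n - S) ≤ 1 := pow_le_one₀ hμ1' (by linarith)
      have hall : (n.choose S : ℝ) * (1 / d) ^ S * (1 - 1 / d) ^ (n - S) *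
        F ((S.choose k : ℝ) / (n.choose k : ℝ)) ^ M ≤
          Real.exp (S * (1 - Real.log s) + S * (-(α * Real.log n)) + M * Real.log (1 + c * s ^ k)) := by
        rw [Real.exp_add, Real.exp_add, ← hdS]
        rw [hlogs, ← sub_eq_add_neg] at hC
        have hnn : 0 ≤ F ((S.choose k : ℝ) / (n.choose k : ℝ)) ^ M := Real.rpow_nonneg (hF0 _ (hq0 S)) _
        calc _ ≤ Real.exp (S * (1 - Real.log s)) * (1 / d) ^ S * 1 * Real.exp (M * Real.log (1 + c * s ^ k)) := by
              gcongr
          _ = _ := by ring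
      refine hall.trans ?_
      have hfin : ∀ x, Real.exp x ≤ ρ → S * (1 - Real.log s) + S * (-(α * Real.log n)) + M * Real.log (1 + c * s ^ k) ≤ S * x →
          Real.exp (S * (1 - Real.log s) + S * (-(α * Real.log n)) + M * Real.log (1 + c * s ^ k)) ≤ ρ ^ S := by
        intro x hx h
        refine (Real.exp_le_exp.2 h).trans ?_
        rw [Real.exp_nat_mul]
        gcongr
      by_cases hc2 : (n:ℝ) ^ (-(α * e3 / 2)) ≤ s
      · apply hfin _ hρ3
        have h1 := log_bound c hc0 k hk hkc s hs0 hs1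
        have h2 : -(α * e3 / 2) * Real.log n ≤ Real.log s := by
          rw [← Real.log_rpow hn0]; exact Real.log_le_log (by positivity) hc2
        have h3 : M * Real.log (1 + c * s ^ k) ≤ S * ((1 - e3) * (α * Real.log n)) := by
          calc _ ≤ M * (s * Real.log (1 + c)) := by gcongr
            _ = S * ((r * Real.log (1 + c)) * (α * Real.log n)) := by rw [hM, hm, hns]; ring
            _ = _ := by rw [he3]
        have h4 : (S:ℝ) * (1 - Real.log s) ≤ S * (1 + (α * e3 / 2) * Real.log n) := by
          gcongr; linarith
        linarith
      · push Not at hc2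
        apply hfin _ hρε
        have h2 : (ε - α) * Real.log n ≤ Real.log s := by
          rw [← Real.log_rpow hn0]; exact Real.log_le_log (by positivity) hcase.le
        have h3 : M * Real.log (1 + c * s ^ k) ≤ S := by
          have h5 : Real.log (1 + c * s ^ k) ≤ c * s ^ k := by
            have := Real.log_le_sub_one_of_pos (show 0 < 1 + c * s ^ k by positivity)
            linarith
          have h6 : s ^ (k - 1) ≤ ((n:ℝ) ^ (-(α * e3 / 2))) ^ (k - 1) := by gcongr
          calc _ ≤ M * (c * s ^ k) := by gcongr
            _ = S * (r * c * (α * Real.log n) * s ^ (k - 1)) := by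
              obtain ⟨j, rfl⟩ : ∃ j, k = j + 1 := ⟨k - 1, by omega⟩
              rw [hM, hm, hns, Nat.add_sub_cancel, pow_succ]; ring
            _ ≤ S * (r * c * (α * Real.log n) * ((n:ℝ) ^ (-(α * e3 / 2))) ^ (k - 1)) := by gcongr
            _ ≤ S * 1 := by gcongr
            _ = S := mul_one _
        have h4 : (S:ℝ) * (1 - Real.log s) ≤ S * (1 - (ε - α) * Real.log n) := by
          gcongr
        linarith
  refine (Finset.sum_le_sum hterm).trans ?_
  rw [Finset.sum_add_distrib]
  refine add_le_add (moment n (1 / d) a hμ0 hμ1 ha0 ha1) ?_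
  rw [Finset.sum_range_succ']
  simp only [Nat.add_eq_zero_iff, one_ne_zero, and_false, if_false, if_true, add_zero]
  have h1 : ∑ i ∈ Finset.range n, ρ ^ (i + 1) = ρ * ∑ i ∈ Finset.range n, ρ ^ i := by
    rw [Finset.mul_sum]; exact Finset.sum_congr rfl fun i _ => by ring
  rw [h1, div_eq_mul_inv]
  refine mul_le_mul_of_nonneg_left ?_ hρ0.le
  rw [← tsum_geometric_of_lt_one hρ0.le hρ1]
  exact (summable_geometric_of_lt_one hρ0.le hρ1).sum_le_tsum _ (fun i _ => by positivity)

lemma tend_log (b : ℝ) (hb : 0 < b) :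
    Filter.Tendsto (fun n : ℕ => Real.log n * (n:ℝ) ^ (-b)) Filter.atTop (nhds 0) := by
  have h := (isLittleO_log_rpow_atTop hb).tendsto_div_nhds_zero
  refine (h.comp tendsto_natCast_atTop_atTop).congr fun n => ?_
  simp only [Function.comp]
  rw [Real.rpow_neg (by positivity), div_eq_mul_inv]

/-- if (2k-1)α > 1, k ≥ τ ln τ/(τ-1) and 0 < r < 1/ln τ, then
limsup E[X²]/E[X]² ≤ 1. -/
theorem stmt0 (α p r τ : ℝ) (k : ℕ) (hα : 0 < α) (hk : 2 ≤ k)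
    (hp0 : 0 < p) (hp1 : p < 1) (hτ : τ = 1 / (1 - p))
    (hkα : (2 * (k : ℝ) - 1) * α > 1)
    (hkτ : (k : ℝ) ≥ τ * Real.log τ / (τ - 1))
    (hr0 : 0 < r) (hr : r < 1 / Real.log τ) :
    Filter.limsup (fun n : ℕ => E2RB α p r k n / E1RB α p r n ^ 2) Filter.atTop ≤ 1 := by
  have hp1' : 0 < 1 - p := by linarith
  obtain ⟨c, hc⟩ : ∃ c, c = p / (1 - p) := ⟨_, rfl⟩
  have hc0 : 0 < c := by rw [hc]; positivity
  have hτc : τ = 1 + c := by rw [hτ, hc]; field_simp; ring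
  subst hτc
  have hL : 0 < Real.log (1 + c) := Real.log_pos (by linarith)
  have hkc : (1 + c) * Real.log (1 + c) ≤ k * c := by
    have h : (1 + c) * Real.log (1 + c) / (1 + c - 1) ≤ k := hkτ
    rw [add_sub_cancel_left, div_le_iff₀ hc0] at h
    exact h
  obtain ⟨e3, he3⟩ : ∃ e3, e3 = 1 - r * Real.log (1 + c) := ⟨_, rfl⟩
  have he30 : 0 < e3 := by
    rw [lt_div_iff₀ hL] at hr; linarith
  have hk' : (2:ℝ) ≤ k := by exact_mod_cast hk
  have hkc1 : ((k - 1 : ℕ) : ℝ) = (k:ℝ) - 1 := by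
    rw [Nat.cast_sub (by omega)]; simp
  -- choose ε
  obtain ⟨ε, hε0, hεα, hεk⟩ : ∃ ε : ℝ, 0 < ε ∧ ε < α ∧ (2 * (k:ℝ) - 2) * ε < (2 * (k:ℝ) - 1) * α - 1 := by
    have hx : 0 < ((2 * (k:ℝ) - 1) * α - 1) / (2 * (k:ℝ)) := div_pos (by linarith) (by linarith)
    refine ⟨min (α / 2) (((2 * (k:ℝ) - 1) * α - 1) / (2 * (k:ℝ))), lt_min (by linarith) hx, 
      lt_of_le_of_lt (min_le_left _ _) (by linarith), ?_⟩
    have h1 := min_le_right (α / 2) (((2 * (k:ℝ) - 1) * α - 1) / (2 * (k:ℝ)))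
    have h2 : ((2 * (k:ℝ) - 1) * α - 1) / (2 * (k:ℝ)) * (2 * (k:ℝ)) = (2 * (k:ℝ) - 1) * α - 1 := by
      field_simp
    calc _ ≤ (2 * (k:ℝ) - 2) * (((2 * (k:ℝ) - 1) * α - 1) / (2 * (k:ℝ))) := by
          apply mul_le_mul_of_nonneg_left h1; linarith
      _ < _ := by nlinarith
  set a : ℕ → ℝ := fun n => 2 * r * c * k * (α * Real.log n) * ((n:ℝ) ^ (ε - α)) ^ (k - 1) with ha
  set ρ : ℕ → ℝ := fun n => Real.exp (2 - min ε (α * e3 / 2) * Real.log n) with hρ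
  have hlog : Filter.Tendsto (fun n : ℕ => Real.log n) Filter.atTop Filter.atTop :=
    Real.tendsto_log_atTop.comp tendsto_natCast_atTop_atTop
  have hpow : ∀ x : ℝ, ∀ n : ℕ, ((n:ℝ) ^ x) ^ (k - 1) = (n:ℝ) ^ (x * ((k:ℝ) - 1)) := by
    intro x n
    rw [← Real.rpow_natCast, ← Real.rpow_mul (by positivity), hkc1]
  have ta : Filter.Tendsto a Filter.atTop (nhds 0) := by
    have := (tend_log ((α - ε) * ((k:ℝ) - 1)) (mul_pos (by linarith) (by linarith))).const_mul (2 * r * c * k * α)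
    rw [mul_zero] at this
    refine this.congr fun n => ?_
    simp only [ha]
    rw [hpow, show (ε - α) * ((k:ℝ) - 1) = -((α - ε) * ((k:ℝ) - 1)) by ring]; ring
  have tB : Filter.Tendsto (fun n : ℕ => r * c * (α * Real.log n) * ((n:ℝ) ^ (-(α * e3 / 2))) ^ (k - 1)) Filter.atTop (nhds 0) := by
    have := (tend_log ((α * e3 / 2) * ((k:ℝ) - 1)) (mul_pos (by positivity) (by linarith))).const_mul (r * c * α)
    rw [mul_zero] at this
    refine this.congr fun n => ?_
    rw [hpow, neg_mul]; ring
  have tv : Filter.Tendsto (fun n : ℕ => a n ^ 2 * (n * (1 / dRB α n))) Filter.atTop (nhds 0) := by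
    have := ((tend_log (((α - ε) * (2 * (k:ℝ) - 2) + α - 1) / 2) (by nlinarith)).pow 2).const_mul ((2 * r * c * k * α) ^ 2)
    rw [zero_pow two_ne_zero, mul_zero] at this
    refine this.congr' ?_
    filter_upwards [eventually_ge_atTop 1] with n hn
    have hn0 : (0:ℝ) < n := by exact_mod_cast hn
    have h1 : (n:ℝ) * (1 / dRB α n) = (n:ℝ) ^ (1 - α) := by
      unfold dRB; rw [Real.rpow_sub hn0, Real.rpow_one]; ring
    simp only [ha]
    rw [h1, hpow]
    have h2 : ((n:ℝ) ^ (-(((α - ε) * (2 * (k:ℝ) - 2) + α - 1) / 2))) ^ 2 = ((n:ℝ) ^ ((ε - α) * ((k:ℝ) - 1))) ^ 2 * (n:ℝ) ^ (1 - α) := by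
      rw [← Real.rpow_natCast, ← Real.rpow_natCast, ← Real.rpow_mul hn0.le, ← Real.rpow_mul hn0.le, ← Real.rpow_add hn0]
      congr 1; push_cast; ring
    rw [mul_pow (Real.log n), h2]; ring
  have tρ : Filter.Tendsto ρ Filter.atTop (nhds 0) := by
    apply Real.tendsto_exp_atBot.comp
    have hm : 0 < min ε (α * e3 / 2) := lt_min hε0 (by positivity)
    exact tendsto_const_nhds.add_atBot (tendsto_neg_atTop_atBot.comp (hlog.const_mul_atTop hm))
  have tδ : Filter.Tendsto (fun n : ℕ => dRB α n ^ (-(k:ℝ))) Filter.atTop (nhds 0) := by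
    have : Filter.Tendsto (fun n : ℕ => dRB α n) Filter.atTop Filter.atTop :=
      (tendsto_rpow_atTop hα).comp tendsto_natCast_atTop_atTop
    exact (tendsto_rpow_neg_atTop (by linarith)).comp this
  have tδ2 := tδ.const_mul (2 * c)
  rw [mul_zero] at tδ2
  have hev : ∀ᶠ n : ℕ in Filter.atTop, 0 ≤ E2RB α p r k n / E1RB α p r n ^ 2 ∧ 
    E2RB α p r k n / E1RB α p r n ^ 2 ≤
      Real.exp (a n ^ 2 * (n * (1 / dRB α n))) + 2 * √(a n ^ 2 * (n * (1 / dRB α n))) + ρ n / (1 - ρ n) := by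
    filter_upwards [eventually_ge_atTop 2, tδ.eventually_le_const (show (0:ℝ) < 1 / 2 by norm_num),
      tδ2.eventually_le_const one_pos, ta.eventually_le_const one_pos, tB.eventually_le_const one_pos,
      tρ.eventually_lt_const one_pos] with n h1 h2 h3 h4 h5 h6
    have hl : 0 ≤ Real.log n := Real.log_natCast_nonneg n
    refine ratio_bound α p r k n hα hk c hp1 hc hc0 hkc hr0 ε e3 (by linarith) h1 h2 h3 (a n) rfl h4 h5 (ρ n) h6 ?_ ?_
    · apply Real.exp_le_exp.2
      have := mul_le_mul_of_nonneg_right (min_le_left ε (α * e3 / 2)) hl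
      linarith
    · apply Real.exp_le_exp.2
      have := mul_le_mul_of_nonneg_right (min_le_right ε (α * e3 / 2)) hl
      linarith
  have tb : Filter.Tendsto (fun n : ℕ => Real.exp (a n ^ 2 * (n * (1 / dRB α n))) + 2 * √(a n ^ 2 * (n * (1 / dRB α n))) + ρ n / (1 - ρ n)) Filter.atTop (nhds 1) := by
    have h1 := (Real.continuous_exp.tendsto 0).comp tv
    have h2 := ((Real.continuous_sqrt.tendsto 0).comp tv).const_mul 2
    have h3 := tρ.div (tρ.const_sub 1) (by norm_num)
    have := (h1.add h2).add h3
    simpa using this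
  rw [← tb.limsup_eq]
  refine Filter.limsup_le_limsup (hev.mono fun n h => h.2) ?_ tb.isBoundedUnder_le
  exact Filter.IsBoundedUnder.isCoboundedUnder_le ⟨0, by
    rw [Filter.eventually_map]; exact hev.mono fun n h => h.1⟩
end

section
/- Suppose (2k−1)·α ≤ 1, let λ > 0 be a constant, and let ρ be a constant with 0 < ρ < α. Then ∑_{S=⌈n·η₁(n)⌉}^{⌊n^{1−ρ}⌋} C(n,S)·(1/d)^S·(1−1/d)^{n−S} → 1/2 as n → ∞. -/
open Filter Finset

open MeasureTheory ProbabilityTheory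

noncomputable def binM (n : ℕ) (p σ : ℝ) : Measure ℝ :=
  ∑ S ∈ Finset.range (n+1), ENNReal.ofReal ((n.choose S : ℝ) * p^S * (1-p)^(n-S)) •
    Measure.dirac (((S:ℝ) - n * p)/σ)

lemma binW_nonneg (n S : ℕ) {p : ℝ} (h0 : 0 ≤ p) (h1 : p ≤ 1) :
    0 ≤ (n.choose S : ℝ) * p^S * (1-p)^(n-S) := by
  have : 0 ≤ 1 - p := by linarith
  positivity

lemma binM_apply (n : ℕ) {p : ℝ} (σ : ℝ) (h0 : 0 ≤ p) (h1 : p ≤ 1) (E : Set ℝ) (hE : MeasurableSet E)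
    [DecidablePred (fun S : ℕ => ((S:ℝ) - n * p)/σ ∈ E)] :
    binM n p σ E = ENNReal.ofReal (∑ S ∈ (Finset.range (n+1)).filter (fun S : ℕ => ((S:ℝ) - n * p)/σ ∈ E),
      (n.choose S : ℝ) * p^S * (1-p)^(n-S)) := by
  rw [ENNReal.ofReal_sum_of_nonneg (fun S _ => binW_nonneg n S h0 h1), Finset.sum_filter]
  simp only [binM, Measure.coe_finsetSum, Finset.sum_apply, Measure.smul_apply, smul_eq_mul]
  refine Finset.sum_congr rfl fun S _ => ?_
  rw [Measure.dirac_apply' _ hE]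
  by_cases h : ((S:ℝ) - n * p)/σ ∈ E <;> simp [h]

lemma binM_prob (n : ℕ) {p : ℝ} (σ : ℝ) (h0 : 0 ≤ p) (h1 : p ≤ 1) :
    IsProbabilityMeasure (binM n p σ) := by
  classical
  constructor
  rw [binM_apply n σ h0 h1 _ MeasurableSet.univ]
  simp only [Set.mem_univ, Finset.filter_true]
  have := add_pow p (1-p) n
  rw [show p + (1-p) = 1 by ring, one_pow] at this
  rw [← ENNReal.ofReal_one]
  congr 1
  refine Eq.trans ?_ this.symm
  exact Finset.sum_congr rfl fun S _ => by ring

lemma binM_charFun (n : ℕ) {p : ℝ} (σ : ℝ) (h0 : 0 ≤ p) (h1 : p ≤ 1) (t : ℝ) :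
    charFun (binM n p σ) t =
      ((1-p) * Complex.exp ((-(p * (t/σ)) : ℝ) * Complex.I)
        + p * Complex.exp (((1-p) * (t/σ) : ℝ) * Complex.I))^n := by
  rw [charFun_apply_real, binM, integral_finsetSum_measure, add_comm (_ * _), add_pow]
  · refine Finset.sum_congr rfl fun S hS => ?_
    rw [integral_smul_measure, integral_dirac, ENNReal.toReal_ofReal (binW_nonneg n S h0 h1),
      mul_pow, mul_pow, ← Complex.exp_nat_mul, ← Complex.exp_nat_mul]
    have hS' : S ≤ n := by simpa [Nat.lt_succ_iff] using hS
    have : Complex.exp (t * ((((S:ℝ) - n * p)/σ : ℝ):ℂ) * Complex.I)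
      = Complex.exp (S * ((((1-p) * (t/σ) : ℝ):ℂ) * Complex.I)) *
       Complex.exp (((n-S : ℕ):ℂ) * ((-(p * (t/σ)) : ℝ) * Complex.I)) := by
      rw [← Complex.exp_add]
      congr 1
      push_cast [Nat.cast_sub hS']
      ring
    rw [this, Complex.real_smul]
    push_cast
    ring
  · intro i _
    apply Integrable.smul_measure _ ENNReal.ofReal_ne_top
    exact integrable_dirac (by simp)

lemma exp3 (x : ℝ) (hx : |x| ≤ 1) :
    ‖Complex.exp (x * Complex.I) - (1 + x * Complex.I - x^2/2)‖ ≤ |x|^3 := by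
  have hn : ‖(x:ℂ) * Complex.I‖ = |x| := by simp
  have := Complex.exp_bound (x := (x:ℂ) * Complex.I) (by rw [hn]; exact hx) (n := 3) (by norm_num)
  rw [hn] at this
  simp only [Finset.sum_range_succ, Finset.sum_range_zero] at this
  have e : (0:ℂ) + ((x:ℂ) * Complex.I) ^ 0 / (Nat.factorial 0 : ℂ) + (x * Complex.I) ^ 1 / (Nat.factorial 1 : ℂ) +
     (x * Complex.I) ^ 2 / (Nat.factorial 2 : ℂ) = 1 + x * Complex.I - x^2/2 := by
    simp [Nat.factorial, mul_pow]; ring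
  rw [e] at this
  refine this.trans ?_
  have : 0 ≤ |x|^3 := by positivity
  norm_num [Nat.factorial]
  linarith

lemma char_est (p θ : ℝ) (h0 : 0 ≤ p) (h1 : p ≤ 1) (hθ : |θ| ≤ 1) :
    ‖((1-p) * Complex.exp ((-(p * θ) : ℝ) * Complex.I)
        + p * Complex.exp (((1-p) * θ : ℝ) * Complex.I)) - 1 + (p * (1-p) * θ^2/2 : ℝ)‖
      ≤ p * (1-p) * |θ|^3 := by
  have h2 : 0 ≤ 1 - p := by linarith
  have a1 : |-(p*θ)| = p * |θ| := by rw [abs_neg, abs_mul, abs_of_nonneg h0]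
  have a2 : |(1-p)*θ| = (1-p) * |θ| := by rw [abs_mul, abs_of_nonneg h2]
  have b := abs_nonneg θ
  have e1 := exp3 (-(p*θ)) (by rw [a1]; nlinarith)
  have e2 := exp3 ((1-p)*θ) (by rw [a2]; nlinarith)
  rw [a1] at e1
  rw [a2] at e2
  set A := Complex.exp ((-(p * θ) : ℝ) * Complex.I)
  set B := Complex.exp (((1-p) * θ : ℝ) * Complex.I)
  have key : ((1-p) * A + p * B) - 1 + (p * (1-p) * θ^2/2 : ℝ) =
     ((1-p : ℝ):ℂ) * (A - (1 + (-(p * θ) : ℝ) * Complex.I - ((-(p * θ) : ℝ):ℂ)^2/2))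
      + ((p:ℝ):ℂ) * (B - (1 + ((1-p) * θ : ℝ) * Complex.I - (((1-p) * θ : ℝ):ℂ)^2/2)) := by
    push_cast; ring
  rw [key]
  refine (norm_add_le _ _).trans ?_
  rw [norm_mul, norm_mul, Complex.norm_real, Complex.norm_real, Real.norm_of_nonneg h0,
    Real.norm_of_nonneg h2]
  have c1 := mul_le_mul_of_nonneg_left e1 h2
  have c2 := mul_le_mul_of_nonneg_left e2 h0
  refine (add_le_add c1 c2).trans ?_
  have h3 : 0 ≤ p * (1-p) * |θ|^3 := by positivity
  have : (1-p) * (p*|θ|)^3 + p * ((1-p)*|θ|)^3 = (p * (1-p) * |θ|^3) * (1 - 2 * (p * (1-p))) := by ring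
  rw [this]
  have : 0 ≤ p * (1-p) := by positivity
  nlinarith

lemma gauss_half : gaussianReal 0 1 (Set.Ioi 0) = 1/2 := by
  have := nullSingletonClass_gaussianReal (μ := 0) (v := 1) (by simp)
  have h : gaussianReal 0 1 (Set.Iio 0) = gaussianReal 0 1 (Set.Ioi 0) := by
    conv_rhs => rw [← neg_zero, ← gaussianReal_map_neg]
    rw [Measure.map_apply (by fun_prop) measurableSet_Ioi]
    congr 1
    ext x; simp
  have h1 : gaussianReal 0 1 (Set.Iic 0) + gaussianReal 0 1 (Set.Ioi 0) = 1 := by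
    rw [← Set.compl_Iic, measure_add_measure_compl measurableSet_Iic]; simp
  rw [← Iio_ae_eq_Iic.measure_eq, h, ← two_mul] at h1
  rw [ENNReal.eq_div_iff (by simp) (by simp), h1]

lemma clt (p : ℕ → ℝ) (h0 : ∀ n, 0 ≤ p n) (h1 : ∀ n, p n ≤ 1) (σ : ℕ → ℝ)
    (hs : ∀ n, σ n ^2 = n * p n * (1 - p n)) (hσ : Tendsto σ atTop atTop) (t : ℝ) :
    Tendsto (fun n => charFun (binM n (p n) (σ n)) t) atTop (nhds (charFun (gaussianReal 0 1) t)) := by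
  simp_rw [binM_charFun _ _ (h0 _) (h1 _)]
  rw [charFun_gaussianReal]
  set Z : ℕ → ℂ := fun n => ((1-p n) * Complex.exp ((-(p n * (t/σ n)) : ℝ) * Complex.I)
        + p n * Complex.exp (((1-p n) * (t/σ n) : ℝ) * Complex.I)) with hZ
  have e : ∀ n, Z n ^ n = (1 + (Z n - 1))^n := fun n => by ring
  change Tendsto (fun n => Z n ^ n) _ _
  simp_rw [e]
  apply Complex.tendsto_one_add_pow_exp_of_tendsto
  rw [tendsto_iff_norm_sub_tendsto_zero]
  have lim : Tendsto (fun n => |t|^3 / σ n) atTop (nhds 0) := hσ.const_div_atTop _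
  refine squeeze_zero' (.of_forall fun _ => norm_nonneg _) ?_ lim
  filter_upwards [hσ.eventually_ge_atTop (max 1 |t|)] with n hn
  have p1 : 1 ≤ σ n := (le_max_left _ _).trans hn
  have p2 : |t| ≤ σ n := (le_max_right _ _).trans hn
  have p0 : 0 < σ n := by linarith
  have aθ : |t/σ n| = |t|/σ n := by rw [abs_div, abs_of_pos p0]
  have est := char_est (p n) (t/σ n) (h0 n) (h1 n) (by rw [aθ]; exact (div_le_one p0).2 p2)
  have hq : (n:ℝ) * (p n * (1 - p n) * (t/σ n)^2/2) = t^2/2 := by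
    have : (n:ℝ) * (p n * (1 - p n) * (t/σ n)^2/2) = (n * p n * (1 - p n)) * (t/σ n)^2/2 := by ring
    rw [this, ← hs]; field_simp
  have hq2 : (n:ℝ) * (p n * (1 - p n) * |t/σ n|^3) = |t|^3/σ n := by
    have : (n:ℝ) * (p n * (1 - p n) * |t/σ n|^3) = (n * p n * (1 - p n)) * |t/σ n|^3 := by ring
    rw [this, ← hs, aθ]; field_simp
  rw [← hq2]
  have : (n:ℂ) * (Z n - 1) - (t * (0:ℝ) * Complex.I - (1:NNReal) * t^2/2)
     = (n:ℂ) * (Z n - 1 + (p n * (1 - p n) * (t/σ n)^2/2 : ℝ)) := by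
    have hq' : (n:ℂ) * ((p n * (1 - p n) * (t/σ n)^2/2 : ℝ) : ℂ) = t^2/2 := by exact_mod_cast hq
    rw [mul_add, hq']; simp
  rw [this, norm_mul, Complex.norm_natCast]
  exact mul_le_mul_of_nonneg_left est (Nat.cast_nonneg n)

lemma key (p : ℕ → ℝ) (h0 : ∀ n, 0 ≤ p n) (h1 : ∀ n, p n ≤ 1) (σ : ℕ → ℝ)
    (hs : ∀ n, σ n ^2 = n * p n * (1 - p n)) (hσ : Tendsto σ atTop atTop)
    (a b : ℕ → ℝ) (ha0 : ∀ᶠ n in atTop, 0 ≤ a n) (ha : Tendsto a atTop (nhds 0))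
    (hb : Tendsto b atTop atTop) :
    Tendsto (fun n => binM n (p n) (σ n) (Set.Icc (a n) (b n))) atTop (nhds (1/2)) := by
  have := nullSingletonClass_gaussianReal (μ := 0) (v := 1) (by simp)
  let M : ℕ → ProbabilityMeasure ℝ := fun n => ⟨binM n (p n) (σ n), binM_prob n _ (h0 n) (h1 n)⟩
  let G : ProbabilityMeasure ℝ := ⟨gaussianReal 0 1, inferInstance⟩
  have hM : Tendsto M atTop (nhds G) :=
    ProbabilityMeasure.tendsto_of_tendsto_charFun (clt p h0 h1 σ hs hσ)
  have hU : Tendsto (fun n => binM n (p n) (σ n) (Set.Ici 0)) atTop (nhds (1/2)) := by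
    have := ProbabilityMeasure.tendsto_measure_of_null_frontier_of_tendsto' hM (E := Set.Ici 0)
      (by simp [G])
    rw [← gauss_half, Ioi_ae_eq_Ici.measure_eq]
    exact this
  have hL : ∀ m : ℕ, Tendsto (fun n => binM n (p n) (σ n) (Set.Icc (1/((m:ℝ)+1)) m)) atTop
      (nhds (gaussianReal 0 1 (Set.Icc (1/((m:ℝ)+1)) m))) := by
    intro m
    refine ProbabilityMeasure.tendsto_measure_of_null_frontier_of_tendsto' hM (E := Set.Icc (1/((m:ℝ)+1)) m) ?_
    refine measure_mono_null (t := {1/((m:ℝ)+1), (m:ℝ)}) ?_ ?_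
    · intro x hx
      rw [frontier, closure_Icc, interior_Icc] at hx
      simp only [Set.mem_sdiff, Set.mem_Icc, Set.mem_Ioo, not_and, not_lt] at hx
      obtain ⟨⟨h1, h2⟩, h3⟩ := hx
      rcases h1.lt_or_eq with h | h
      · exact Or.inr (le_antisymm h2 (h3 h))
      · exact Or.inl h.symm
    · exact (Set.toFinite _).measure_zero (gaussianReal 0 1)
  have hUn : Tendsto (fun m : ℕ => gaussianReal 0 1 (Set.Icc (1/((m:ℝ)+1)) m)) atTop (nhds (1/2)) := by
    have hmono : Monotone (fun m : ℕ => Set.Icc (1/((m:ℝ)+1)) (m:ℝ)) := by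
      intro m m' h
      have : (m:ℝ) ≤ m' := by exact_mod_cast h
      exact Set.Icc_subset_Icc (by gcongr) this
    have h := tendsto_measure_iUnion_atTop (μ := gaussianReal 0 1) hmono
    have hu : (⋃ m : ℕ, Set.Icc (1/((m:ℝ)+1)) (m:ℝ)) = Set.Ioi 0 := by
      ext x
      simp only [Set.mem_iUnion, Set.mem_Icc, Set.mem_Ioi]
      constructor
      · rintro ⟨m, h, _⟩
        exact lt_of_lt_of_le (by positivity) h
      · intro hx
        obtain ⟨m1, hm1⟩ := exists_nat_one_div_lt hx
        obtain ⟨m2, hm2⟩ := exists_nat_ge x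
        refine ⟨max m1 m2, ?_, hm2.trans (by simp)⟩
        refine le_trans ?_ hm1.le
        have : (m1:ℝ) ≤ (max m1 m2 : ℕ) := by exact_mod_cast le_max_left _ _
        gcongr
    rw [hu, gauss_half] at h
    exact h
  rw [tendsto_order]
  constructor
  · intro c hc
    obtain ⟨m, hm⟩ := (hUn.eventually_const_lt hc).exists
    filter_upwards [(hL m).eventually_const_lt hm, ha.eventually_lt_const (show (0:ℝ) < 1/((m:ℝ)+1) by positivity),
      hb.eventually_ge_atTop (m:ℝ)] with n q1 q2 q3
    exact lt_of_lt_of_le q1 (measure_mono (Set.Icc_subset_Icc q2.le q3))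
  · intro c hc
    filter_upwards [hU.eventually_lt_const hc, ha0] with n q1 q2
    refine lt_of_le_of_lt (measure_mono ?_) q1
    intro x hx
    exact q2.trans hx.1

/-- if (2k-1)α ≤ 1, λ > 0 and 0 < ρ < α, then
∑_{S=⌈nη₁⌉}^{⌊n^{1-ρ}⌋} B_n(S) → 1/2. -/
theorem stmt18 (α lam ρ : ℝ) (k : ℕ) (hα : 0 < α) (hk : 2 ≤ k)
    (hkα : (2 * (k : ℝ) - 1) * α ≤ 1) (hlam : 0 < lam) (hρ0 : 0 < ρ) (hρα : ρ < α) :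
    Filter.Tendsto
      (fun n : ℕ => ∑ S ∈ Finset.Icc ⌈(n : ℝ) * eta1 α lam k n⌉₊ ⌊(n : ℝ) ^ (1 - ρ)⌋₊,
        BRB α n S)
      Filter.atTop (nhds (1 / 2)) := by
  classical
  have hk' : (2:ℝ) ≤ k := by exact_mod_cast hk
  have hα1 : α < 1 := by nlinarith
  set p : ℕ → ℝ := fun n => 1 / dRB α n with hp
  have h0 : ∀ n, 0 ≤ p n := fun n => by
    simp only [hp, dRB]; positivity
  have h1 : ∀ n, p n ≤ 1 := fun n => by
    simp only [hp, dRB]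
    rcases Nat.eq_zero_or_pos n with h | h
    · subst h; simp [Real.zero_rpow hα.ne']
    · have : (1:ℝ) ≤ n := by exact_mod_cast h
      have := Real.one_le_rpow this hα.le
      rw [div_le_one (by linarith)]; exact this
  set σ : ℕ → ℝ := fun n => Real.sqrt (n * p n * (1 - p n)) with hσd
  have hs : ∀ n, σ n ^ 2 = n * p n * (1 - p n) := fun n =>
    Real.sq_sqrt (mul_nonneg (mul_nonneg (Nat.cast_nonneg n) (h0 n)) (by linarith [h1 n]))
  have hσ0 : ∀ n, 0 ≤ σ n := fun n => Real.sqrt_nonneg _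
  set r : ℕ → ℝ := fun n => (n:ℝ) ^ ((1-α)/2) with hr
  have natlim : Tendsto (fun n : ℕ => (n:ℝ)) atTop atTop := tendsto_natCast_atTop_atTop
  have hrlim : Tendsto r atTop atTop := (tendsto_rpow_atTop (by linarith)).comp natlim
  have hdlim : Tendsto (fun n => dRB α n) atTop atTop := (tendsto_rpow_atTop hα).comp natlim
  have hLlim : Tendsto (fun n => Real.log (dRB α n)) atTop atTop := Real.tendsto_log_atTop.comp hdlim
  have hplim : Tendsto p atTop (nhds 0) := hdlim.const_div_atTop 1
  have hnp : ∀ n : ℕ, 1 ≤ n → (n:ℝ) * p n = (n:ℝ)^(1-α) := by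
    intro n hn
    have : (0:ℝ) < n := by exact_mod_cast hn
    simp only [hp, dRB]
    rw [Real.rpow_sub this, Real.rpow_one]; ring
  have hr2 : ∀ n : ℕ, 1 ≤ n → (r n)^2 = (n:ℝ) * p n := by
    intro n hn
    rw [hnp n hn]
    simp only [hr]
    rw [← Real.rpow_natCast, ← Real.rpow_mul (Nat.cast_nonneg n)]
    congr 1; push_cast; ring
  have hr0 : ∀ n, 0 ≤ r n := fun n => Real.rpow_nonneg (Nat.cast_nonneg n) _
  have hσr : ∀ᶠ n in atTop, r n / 2 ≤ σ n ∧ σ n ≤ r n := by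
    filter_upwards [eventually_ge_atTop 1, hplim.eventually_lt_const (show (0:ℝ) < 1/2 by norm_num)]
      with n hn hpn
    have e1 : σ n ^ 2 = (r n)^2 * (1 - p n) := by rw [hs, hr2 n hn]
    constructor
    · refine (fun h h2 => (abs_le_of_sq_le_sq' h h2).2) ?_ (hσ0 n)
      rw [e1]; nlinarith [sq_nonneg (r n)]
    · refine (fun h h2 => (abs_le_of_sq_le_sq' h h2).2) ?_ (hr0 n)
      rw [e1]; nlinarith [sq_nonneg (r n), h0 n]
  have hσlim : Tendsto σ atTop atTop :=
    tendsto_atTop_mono' _ (hσr.mono fun n h => h.1) (hrlim.atTop_div_const (by norm_num))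
  set a : ℕ → ℝ := fun n => ((n:ℝ) * eta1 α lam k n - n * p n) / σ n with had
  set b : ℕ → ℝ := fun n => ((n:ℝ) ^ (1-ρ) - n * p n) / σ n with hbd
  have hanum : ∀ n : ℕ, 1 ≤ n → (n:ℝ) * eta1 α lam k n - n * p n
      = lam * (n:ℝ)^(((k:ℝ)-1)*α) / Real.log (dRB α n) := by
    intro n hn
    have : (0:ℝ) < n := by exact_mod_cast hn
    simp only [eta1, hp]
    rw [Real.rpow_sub this, Real.rpow_one]
    have h1 : (n:ℝ)^(((k:ℝ)-1)*α) ≠ 0 := (Real.rpow_pos_of_pos this _).ne'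
    rw [mul_add, add_sub_cancel_left]
    by_cases hL : Real.log (dRB α n) = 0
    · simp [hL]
    · field_simp
  have ha0 : ∀ᶠ n in atTop, 0 ≤ a n := by
    filter_upwards [eventually_ge_atTop 1, hLlim.eventually_ge_atTop 0] with n hn hL
    simp only [had]
    rw [hanum n hn]
    exact div_nonneg (div_nonneg (mul_nonneg hlam.le (Real.rpow_nonneg (Nat.cast_nonneg n) _)) hL) (hσ0 n)
  have ha : Tendsto a atTop (nhds 0) := by
    refine squeeze_zero' ha0 ?_ (hLlim.const_div_atTop (2*lam))
    filter_upwards [eventually_ge_atTop 1, hLlim.eventually_ge_atTop 1, hσr,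
      hσlim.eventually_ge_atTop 1] with n hn hL hs1 hs2
    simp only [had]
    rw [hanum n hn]
    have hn1 : (1:ℝ) ≤ n := by exact_mod_cast hn
    have hle : (n:ℝ)^(((k:ℝ)-1)*α) ≤ r n := by
      apply Real.rpow_le_rpow_of_exponent_le hn1
      linarith
    rw [div_le_iff₀ (by linarith), div_mul_eq_mul_div]
    apply div_le_div_of_nonneg_right _ (by linarith)
    nlinarith [hs1.1]
  have hb : Tendsto b atTop atTop := by
    refine tendsto_atTop_mono' _ ?_ hrlim
    have hq : Tendsto (fun n : ℕ => (n:ℝ)^(α-ρ)) atTop atTop :=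
      (tendsto_rpow_atTop (by linarith)).comp natlim
    filter_upwards [eventually_ge_atTop 1, hσr, hσlim.eventually_ge_atTop 1,
      hq.eventually_ge_atTop 2] with n hn hs1 hs2 hq2
    have hn0 : (0:ℝ) < n := by exact_mod_cast hn
    simp only [hbd]
    rw [le_div_iff₀ (by linarith)]
    have : (n:ℝ)^(1-ρ) = (r n)^2 * (n:ℝ)^(α-ρ) := by
      rw [hr2 n hn, hnp n hn, ← Real.rpow_add hn0]; congr 1; ring
    rw [this, ← hr2 n hn]
    nlinarith [hr0 n, hs1.2, sq_nonneg (r n)]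
  have main := key p h0 h1 σ hs hσlim a b ha0 ha hb
  have main2 := (ENNReal.tendsto_toReal (by simp)).comp main
  have hhalf : ((1/2 : ENNReal)).toReal = 1/2 := by simp
  rw [hhalf] at main2
  refine main2.congr' ?_
  filter_upwards [eventually_ge_atTop 1, hσlim.eventually_ge_atTop 1] with n hn hs2
  have hn1 : (1:ℝ) ≤ n := by exact_mod_cast hn
  have hσp : 0 < σ n := by linarith
  simp only [Function.comp]
  rw [binM_apply n _ (h0 n) (h1 n) _ measurableSet_Icc, ENNReal.toReal_ofReal
    (Finset.sum_nonneg fun S _ => binW_nonneg n S (h0 n) (h1 n))]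
  apply Finset.sum_congr _ (fun S _ => rfl)
  ext S
  have hle : (n:ℝ)^(1-ρ) ≤ n := by
    conv_rhs => rw [← Real.rpow_one (n:ℝ)]
    exact Real.rpow_le_rpow_of_exponent_le hn1 (by linarith)
  have hiff : ((S:ℝ) - n * p n)/σ n ∈ Set.Icc (a n) (b n) ↔
      (n:ℝ) * eta1 α lam k n ≤ S ∧ (S:ℝ) ≤ (n:ℝ)^(1-ρ) := by
    simp only [had, hbd, Set.mem_Icc]
    rw [div_le_div_iff_of_pos_right hσp, div_le_div_iff_of_pos_right hσp]
    constructor <;> rintro ⟨h, h'⟩ <;> constructor <;> linarith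
  rw [Finset.mem_filter, hiff, Finset.mem_Icc, Nat.ceil_le, Nat.le_floor_iff (by positivity),
    Finset.mem_range]
  constructor
  · exact fun h => h.2
  · intro h
    refine ⟨?_, h⟩
    have : (S:ℝ) ≤ n := h.2.trans hle
    have : S ≤ n := by exact_mod_cast this
    omega
end
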